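/- Any normalized Schwartz minimizer of the Pekar functional satisfies the Choquard (Euler–Lagrange) equation: if ψ is a Schwartz function on ℝ³ with ∫|ψ|² = 1 and 𝓔^Pek(ψ) ≤ 𝓔^Pek(η) for every Schwartz η with ∫|η|² = 1, then for all x ∈ ℝ³, −Δψ(x) − 2 (∫_{ℝ³} |ψ(y)|²/|x−y| dy) ψ(x) = (𝓔^Pek(ψ) − D(ψ)) ψ(x), where D(ψ) = ∫_{ℝ³}∫_{ℝ³} |ψ(x)|²|ψ(y)|²/|x−y| dx dy. -/

import Mathlib

open MeasureTheory Real

noncomputable section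

/-- `ℝ³` as a Euclidean space. -/
abbrev E3 := EuclideanSpace ℝ (Fin 3)

/-- The Pekar functional
`𝓔^Pek(ψ) = ∫ |∇ψ|² − ∫∫ |ψ(x)|²|ψ(y)|²/|x−y| dx dy`. -/
def pekarF (ψ : SchwartzMap E3 ℂ) : ℝ :=
  (∫ x : E3, ‖fderiv ℝ ψ x‖ ^ 2) -
    ∫ x : E3, ∫ y : E3, ‖ψ x‖ ^ 2 * ‖ψ y‖ ^ 2 / ‖x - y‖

/-- The Coulomb self-interaction
`D(ψ) = ∫∫ |ψ(x)|²|ψ(y)|²/|x−y| dx dy`. -/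
def DCoul (ψ : SchwartzMap E3 ℂ) : ℝ :=
  ∫ x : E3, ∫ y : E3, ‖ψ x‖ ^ 2 * ‖ψ y‖ ^ 2 / ‖x - y‖

/-- The Laplacian `Δψ(x) = ∑ᵢ ∂²ψ/∂xᵢ²`. -/
def lap (ψ : SchwartzMap E3 ℂ) (x : E3) : ℂ :=
  ∑ i : Fin 3,
    fderiv ℝ (fun y => fderiv ℝ ψ y (EuclideanSpace.single i 1)) x
      (EuclideanSpace.single i 1)

open scoped Topology ContDiff in
theorem exists_norm_sub_le_pow_of_iteratedFDeriv_eq_zero {E : Type} [NormedAddCommGroup E]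
    [NormedSpace ℝ E] (k : ℕ) : ∀ {F : Type} [NormedAddCommGroup F] [NormedSpace ℝ F]
    {g : E → F} {x₀ : E}, ContDiffAt ℝ (k + 1 : ℕ) g x₀ → ∃ C : ℝ, 0 ≤ C ∧ ∃ r > 0,
      ∀ x ∈ Metric.ball x₀ r, (∀ j < k, iteratedFDeriv ℝ (j + 1) g x = 0) →
        ∀ y ∈ Metric.ball x₀ r, ‖g y - g x‖ ≤ C * ‖y - x‖ ^ (k + 1) := by
  induction k with
  | zero =>
    intro F _ _ g x₀ hg
    obtain ⟨K, t, ht, hK⟩ := ContDiffAt.exists_lipschitzOnWith (by simpa using hg)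
    obtain ⟨r, hr, hrt⟩ := Metric.mem_nhds_iff.1 ht
    refine ⟨K, K.2, r, hr, fun x hx _ y hy => ?_⟩
    simpa using hK.norm_sub_le (hrt hy) (hrt hx)
  | succ k ih =>
    intro F _ _ g x₀ hg
    have hg' : ContDiffAt ℝ (k + 1 : ℕ) (fderiv ℝ g) x₀ :=
      hg.fderiv_right (m := ((k + 1 : ℕ) : WithTop ℕ∞)) (by norm_cast)
    obtain ⟨C, hC, r, hr, H⟩ := ih hg'
    obtain ⟨s, hs, hdiff⟩ := Metric.eventually_nhds_iff_ball.1
      (hg.eventually (by simp : ((k + 1 + 1 : ℕ) : WithTop ℕ∞) ≠ ∞))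
    refine ⟨C, hC, min r s, lt_min hr hs, fun x hx hz y hy => ?_⟩
    have hx0 : fderiv ℝ g x = 0 := by
      have := norm_iteratedFDeriv_fderiv (𝕜 := ℝ) (f := g) (x := x) (n := 0)
      rw [hz 0 (by omega)] at this
      simpa using this
    have hsub : Metric.ball x₀ (min r s) ⊆ Metric.ball x₀ r :=
      Metric.ball_subset_ball (min_le_left _ _)
    have hsub' : Metric.ball x₀ (min r s) ⊆ Metric.ball x₀ s :=
      Metric.ball_subset_ball (min_le_right _ _)
    have hvan : ∀ j < k, iteratedFDeriv ℝ (j + 1) (fderiv ℝ g) x = 0 := by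
      intro j hj
      rw [← norm_eq_zero, norm_iteratedFDeriv_fderiv, hz (j + 1) (by omega), norm_zero]
    have key := Convex.norm_image_sub_le_of_norm_fderiv_le (𝕜 := ℝ) (f := g)
      (s := Metric.ball x₀ (min r s) ∩ Metric.closedBall x ‖y - x‖)
      (C := C * ‖y - x‖ ^ (k + 1)) (x := x) (y := y)
      (fun z hz => (hdiff z (hsub' hz.1)).differentiableAt (by simp))
      (fun z hz => by
        have h1 := H x (hsub hx) hvan z (hsub hz.1)
        rw [hx0, sub_zero] at h1
        refine h1.trans ?_
        have h2 : ‖z - x‖ ≤ ‖y - x‖ := by simpa [dist_eq_norm] using hz.2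
        gcongr)
      ((convex_ball _ _).inter (convex_closedBall _ _))
      ⟨hx, by simp⟩ ⟨hy, by simp [dist_eq_norm]⟩
    calc _ ≤ _ := key
      _ = _ := by ring

open scoped Topology in
theorem volume_image_eq_zero_of_locally {E : Type*} [TopologicalSpace E]
    [SecondCountableTopology E] {f : E → ℝ} {S : Set E}
    (h : ∀ x ∈ S, ∃ V ∈ 𝓝[S] x, volume (f '' V) = 0) : volume (f '' S) = 0 := by
  choose! V hV hnull using h
  obtain ⟨t, hts, htc, hcov⟩ := TopologicalSpace.countable_cover_nhdsWithin hV
  refine measure_mono_null (Set.image_mono hcov) ?_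
  rw [Set.image_iUnion₂]
  exact (measure_biUnion_null_iff htc).2 fun x hx => hnull x (hts hx)

open scoped Topology in
theorem volume_image_eq_zero_of_iteratedFDeriv_eq_zero {E : Type} [NormedAddCommGroup E]
    [NormedSpace ℝ E] [FiniteDimensional ℝ E] {f : E → ℝ} {S : Set E} {k : ℕ}
    (hk : Module.finrank ℝ E ≤ k) (hf : ∀ x ∈ S, ContDiffAt ℝ (k + 1 : ℕ) f x)
    (hz : ∀ x ∈ S, ∀ j < k, iteratedFDeriv ℝ (j + 1) f x = 0) : volume (f '' S) = 0 := by
  have hdim : dimH (f '' S) ≤ dimH S / ((k + 1 : ℕ) : NNReal) := by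
    refine dimH_image_le_of_locally_holder_on (by positivity) fun x hx => ?_
    obtain ⟨C, hC, r, hr, H⟩ := exists_norm_sub_le_pow_of_iteratedFDeriv_eq_zero k (hf x hx)
    refine ⟨NNReal.mk C hC, S ∩ Metric.ball x r,
      Filter.inter_mem self_mem_nhdsWithin (mem_nhdsWithin_of_mem_nhds (Metric.ball_mem_nhds x hr)),
      ?_⟩
    intro y hy z hz'
    have h1 := H z hz'.2 (hz z hz'.1) y hy.2
    rw [edist_eq_enorm_sub, edist_eq_enorm_sub, ← ofReal_norm, ← ofReal_norm,
      ENNReal.ofReal_rpow_of_nonneg (norm_nonneg _) (by positivity)]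
    have : ((NNReal.mk C hC : NNReal) : ENNReal) = ENNReal.ofReal C := by
      rw [ENNReal.ofReal, Real.toNNReal_of_nonneg hC]
    rw [this, ← ENNReal.ofReal_mul hC]
    apply ENNReal.ofReal_le_ofReal
    simpa [← Real.rpow_natCast] using h1
  have hdim2 : dimH (f '' S) < ((1 : NNReal) : ENNReal) := by
    have h2 : dimH S ≤ Module.finrank ℝ E := by
      rw [← Real.dimH_univ_eq_finrank E]; exact dimH_mono (Set.subset_univ _)
    refine hdim.trans_lt ?_
    rw [ENNReal.div_lt_iff (by simp) (by simp)]
    refine h2.trans_lt ?_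
    simp only [ENNReal.coe_natCast, ENNReal.coe_one, one_mul]
    exact_mod_cast Nat.lt_succ_of_le hk
  refine measure_zero_of_dimH_lt (d := 1) ?_ hdim2
  rw [NNReal.coe_one, hausdorffMeasure_real]

open scoped Topology ContDiff in
/-- Restriction to the zero set of a function with nonvanishing derivative reduces the
Morse–Sard theorem for a real function to one dimension less. -/
theorem exists_nhds_volume_image_eq_zero_of_fderiv_ne_zero {E : Type} [NormedAddCommGroup E]
    [InnerProductSpace ℝ E] [FiniteDimensional ℝ E] {n k : ℕ}
    (hn : Module.finrank ℝ E = n + 1) {f h : E → ℝ} {x₀ : E}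
    (IH : ∀ (K : Submodule ℝ E), Module.finrank ℝ K = n → ∀ (g : K → ℝ) (T : Set K),
      (∀ x ∈ T, ContDiffAt ℝ (k + 1 : ℕ) g x) → (∀ x ∈ T, fderiv ℝ g x = 0) →
        volume (g '' T) = 0)
    (hf : ContDiffAt ℝ (k + 1 : ℕ) f x₀) (hh : ContDiffAt ℝ (k + 1 : ℕ) h x₀)
    (hne : fderiv ℝ h x₀ ≠ 0) :
    ∃ V ∈ 𝓝 x₀, volume (f '' {x ∈ V | fderiv ℝ f x = 0 ∧ h x = 0}) = 0 := by
  set K : Submodule ℝ E := LinearMap.ker (fderiv ℝ h x₀ : E →ₗ[ℝ] ℝ) with hK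
  have hKn : Module.finrank ℝ K = n := by
    have h1 := LinearMap.finrank_range_add_finrank_ker (fderiv ℝ h x₀ : E →ₗ[ℝ] ℝ)
    have h2 : LinearMap.range (fderiv ℝ h x₀ : E →ₗ[ℝ] ℝ) = ⊤ :=
      LinearMap.range_eq_top.2 (LinearMap.surjective (by
        intro h0; apply hne; ext v; exact congrArg (fun (l : E →ₗ[ℝ] ℝ) => l v) h0))
    rw [h2, finrank_top, Module.finrank_self, hn, ← hK] at h1
    omega
  set P : E →L[ℝ] K := K.orthogonalProjectionOnto
  set A : E →L[ℝ] ℝ × K := (fderiv ℝ h x₀).prod P with hA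
  have hinj : Function.Injective A := by
    rw [injective_iff_map_eq_zero]
    intro v hv
    have hv1 : fderiv ℝ h x₀ v = 0 := congrArg Prod.fst hv
    have hv2 : P v = 0 := congrArg Prod.snd hv
    have hvK : v ∈ K := hv1
    have h3 : P v = ⟨v, hvK⟩ := Submodule.orthogonalProjectionOnto_mem_subspace_eq_self (⟨v, hvK⟩ : K)
    rw [hv2] at h3
    exact (congrArg Subtype.val h3).symm
  set e : E ≃L[ℝ] ℝ × K := (LinearEquiv.ofInjectiveOfFinrankEq (A : E →ₗ[ℝ] ℝ × K) hinj
    (by rw [Module.finrank_prod, hKn, hn, Module.finrank_self]; omega)).toContinuousLinearEquiv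
  have heA : (e : E →L[ℝ] ℝ × K) = A := by ext v <;> rfl
  set Ψ : E → ℝ × K := fun x => (h x, P x)
  have hΨ : ContDiffAt ℝ (k + 1 : ℕ) Ψ x₀ := hh.prodMk P.contDiff.contDiffAt
  have hΨ' : HasFDerivAt Ψ (e : E →L[ℝ] ℝ × K) x₀ := by
    rw [heA]
    exact (hh.differentiableAt (by simp)).hasFDerivAt.prodMk P.hasFDerivAt
  have hk0 : ((k + 1 : ℕ) : WithTop ℕ∞) ≠ 0 := by simp
  set G := hΨ.localInverse hΨ' hk0
  have hG : ContDiffAt ℝ (k + 1 : ℕ) G (Ψ x₀) := hΨ.to_localInverse hΨ' hk0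
  have hinv : ∀ᶠ x in 𝓝 x₀, G (Ψ x) = x :=
    (hΨ.hasStrictFDerivAt' hΨ' hk0).eventually_left_inverse
  have hGev : ∀ᶠ x in 𝓝 x₀, ContDiffAt ℝ (k + 1 : ℕ) G (Ψ x) :=
    hΨ.continuousAt.eventually (hG.eventually (by simp))
  have hfev := hf.eventually (by simp)
  refine ⟨_, Filter.inter_mem hinv (Filter.inter_mem hGev hfev), ?_⟩
  set g : K → ℝ := fun z => f (G (0, z))
  set T : Set E := _
  change volume (f '' T) = 0
  have hcomp : ∀ x ∈ T, g (P x) = f x ∧ ContDiffAt ℝ (k + 1 : ℕ) g (P x) ∧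
      fderiv ℝ g (P x) = 0 := by
    rintro x ⟨⟨hx1, hx2, hx3⟩, hx4, hx5⟩
    simp only [Set.mem_ofPred_eq] at hx1 hx2 hx3
    have hΨx : Ψ x = (0, P x) := by simp [Ψ, hx5]
    rw [hΨx] at hx1 hx2
    have hι : ContDiffAt ℝ (k + 1 : ℕ) (fun z : K => ((0 : ℝ), z)) (P x) :=
      contDiffAt_const.prodMk contDiffAt_id
    have hGι : ContDiffAt ℝ (k + 1 : ℕ) (fun z : K => G (0, z)) (P x) :=
      ContDiffAt.comp (g := G) (P x) hx2 hι
    rw [← hx1] at hx3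
    refine ⟨by simp only [g, hx1], ContDiffAt.comp (g := f) (P x) hx3 hGι, ?_⟩
    have hd : HasFDerivAt f (0 : E →L[ℝ] ℝ) (G (0, P x)) := by
      rw [← hx4]
      have := (hx3.differentiableAt (by simp)).hasFDerivAt
      rwa [hx1] at this ⊢
    have := hd.comp (P x) (hGι.differentiableAt (by simp)).hasFDerivAt
    rw [ContinuousLinearMap.zero_comp] at this
    exact this.fderiv
  have himg : f '' T ⊆ g '' (P '' T) := by
    rintro _ ⟨x, hx, rfl⟩
    exact ⟨P x, ⟨x, hx, rfl⟩, (hcomp x hx).1⟩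
  refine measure_mono_null himg (IH K hKn g _ ?_ ?_)
  · rintro _ ⟨x, hx, rfl⟩; exact (hcomp x hx).2.1
  · rintro _ ⟨x, hx, rfl⟩; exact (hcomp x hx).2.2

theorem exists_real_fderiv_ne_zero {E W : Type*} [NormedAddCommGroup E] [NormedSpace ℝ E]
    [NormedAddCommGroup W] [NormedSpace ℝ W] {H : E → W} {x : E} {m : WithTop ℕ∞} (hm : m ≠ 0)
    (hH : ContDiffAt ℝ m H x) (hne : ‖fderiv ℝ H x‖ ≠ 0) :
    ∃ h : E → ℝ, ContDiffAt ℝ m h x ∧ fderiv ℝ h x ≠ 0 ∧ ∀ y, H y = 0 → h y = 0 := by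
  obtain ⟨w, hw⟩ : ∃ w, fderiv ℝ H x w ≠ 0 := by
    by_contra! hcon; exact hne (norm_eq_zero.2 (ContinuousLinearMap.ext hcon))
  obtain ⟨L, hL⟩ := SeparatingDual.exists_ne_zero (R := ℝ) hw
  refine ⟨L ∘ H, hH.continuousLinearMap_comp L, ?_, fun y hy => by simp [hy]⟩
  rw [(L.hasFDerivAt.comp x (hH.differentiableAt hm).hasFDerivAt).fderiv]
  exact fun h0 => hL (congrArg (fun l : E →L[ℝ] ℝ => l w) h0)

open scoped Topology ContDiff in
theorem exists_volume_image_critical_eq_zero (n : ℕ) :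
    ∃ k : ℕ, ∀ {E : Type} [NormedAddCommGroup E]
    [InnerProductSpace ℝ E] [FiniteDimensional ℝ E], Module.finrank ℝ E = n →
    ∀ (f : E → ℝ) (S : Set E),
      (∀ x ∈ S, ContDiffAt ℝ (k + 1 : ℕ) f x) → (∀ x ∈ S, fderiv ℝ f x = 0) →
        volume (f '' S) = 0 := by
  induction n with
  | zero =>
    refine ⟨0, fun hE f S hf _ => ?_⟩
    exact volume_image_eq_zero_of_iteratedFDeriv_eq_zero (k := 0) hE.le hf (by simp)
  | succ n ih =>
    obtain ⟨k, IH⟩ := ih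
    refine ⟨k + n + 2, fun {E} _ _ _ hE f S hf hS => ?_⟩
    have hcover : f '' S ⊆ f '' {x ∈ S | ∀ j < n + 1, iteratedFDeriv ℝ (j + 1) f x = 0} ∪
        ⋃ j ∈ Finset.range (n + 1), f '' {x ∈ S | iteratedFDeriv ℝ j (fderiv ℝ f) x = 0 ∧
          ‖fderiv ℝ (iteratedFDeriv ℝ j (fderiv ℝ f)) x‖ ≠ 0} := by
      rintro _ ⟨x, hx, rfl⟩
      by_cases hall : ∀ j < n + 1, iteratedFDeriv ℝ (j + 1) f x = 0
      · exact Or.inl ⟨x, ⟨hx, hall⟩, rfl⟩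
      right
      push Not at hall
      classical
      have hmin := fun m => Nat.find_min (H := hall) (m := m)
      obtain ⟨hlt, hne⟩ := Nat.find_spec hall
      rcases hi : Nat.find hall with _ | i
      · exfalso
        rw [hi] at hne
        apply hne
        rw [← norm_eq_zero, ← norm_iteratedFDeriv_fderiv, norm_iteratedFDeriv_zero, hS x hx,
          norm_zero]
      · rw [hi] at hlt hne hmin
        have hprev : iteratedFDeriv ℝ (i + 1) f x = 0 := by
          by_contra hcon
          exact hmin i (by omega) ⟨by omega, hcon⟩
        refine Set.mem_iUnion₂.2 ⟨i, by simp; omega, x, ⟨hx, ?_, ?_⟩, rfl⟩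
        · rw [← norm_eq_zero, norm_iteratedFDeriv_fderiv, hprev, norm_zero]
        · rw [norm_fderiv_iteratedFDeriv, norm_iteratedFDeriv_fderiv]
          exact norm_ne_zero_iff.2 hne
    refine measure_mono_null hcover (measure_union_null ?_ ?_)
    · exact volume_image_eq_zero_of_iteratedFDeriv_eq_zero hE.le
        (fun x hx => (hf x hx.1).of_le (by norm_cast; omega)) fun x hx => hx.2
    · refine (measure_biUnion_null_iff (Finset.countable_toSet _)).2 fun j hj => ?_
      have hj : j < n + 1 := by simpa using hj
      refine volume_image_eq_zero_of_locally fun x hx => ?_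
      obtain ⟨hxS, hx0, hx1⟩ := hx
      have hsm : ContDiffAt ℝ (k + 1 : ℕ) (iteratedFDeriv ℝ j (fderiv ℝ f)) x := by
        refine ContDiffAt.iteratedFDeriv_right (n := ((k + 1 + j : ℕ) : WithTop ℕ∞)) ?_ (by norm_cast)
        exact (hf x hxS).fderiv_right (by norm_cast; omega)
      obtain ⟨h, hh, hne, hz⟩ := exists_real_fderiv_ne_zero (by simp) hsm hx1
      obtain ⟨V, hV, hnull⟩ := exists_nhds_volume_image_eq_zero_of_fderiv_ne_zero (n := n) (k := k)
        (f := f) (h := h) (x₀ := x) hE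
        (fun K hK g T => IH hK g T) ((hf x hxS).of_le (by norm_cast; omega)) hh hne
      refine ⟨_, Filter.inter_mem self_mem_nhdsWithin (mem_nhdsWithin_of_mem_nhds hV),
        measure_mono_null (Set.image_mono ?_) hnull⟩
      rintro y ⟨⟨hyS, hy0, -⟩, hyV⟩
      exact ⟨hyV, hS y hyS, hz y hy0⟩

open scoped ContDiff in
/-- **Morse–Sard theorem** for real-valued smooth functions. -/
theorem volume_image_critical_eq_zero {E : Type} [NormedAddCommGroup E]
    [InnerProductSpace ℝ E] [FiniteDimensional ℝ E] {f : E → ℝ} {S : Set E}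
    (hf : ∀ x ∈ S, ContDiffAt ℝ ∞ f x) (hS : ∀ x ∈ S, fderiv ℝ f x = 0) :
    volume (f '' S) = 0 := by
  obtain ⟨k, hk⟩ := exists_volume_image_critical_eq_zero (Module.finrank ℝ E)
  exact hk rfl f S (fun x hx => (hf x hx).of_le (by exact_mod_cast le_top)) hS

/-- Continuous, bounded and integrable charge densities on `ℝ³`. -/
structure IsDensity (u : E3 → ℝ) : Prop where
  continuous : Continuous u
  integrable : Integrable u
  bounded : ∃ M, ∀ x, |u x| ≤ M

/-- The Coulomb potential generated by the density `u`. -/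
def potential (u : E3 → ℝ) (x : E3) : ℝ := ∫ y : E3, u y / ‖x - y‖

/-- The Coulomb energy of a pair of densities. -/
def coulomb (u v : E3 → ℝ) : ℝ := ∫ p : E3 × E3, u p.1 * v p.2 / ‖p.1 - p.2‖

theorem locallyIntegrable_inv_norm : LocallyIntegrable (fun z : E3 => ‖z‖⁻¹) := by
  refine locallyIntegrable_of_norm_le_rpow (C := 1) (α := 1) (by simp) (by simp) ?_
    (by fun_prop)
  exact .of_forall fun x => by simp [Real.rpow_neg_one]

/-- The singular part of the Coulomb kernel. -/
def coreKernel (z : E3) : ℝ := (Metric.closedBall (0 : E3) 1).indicator (fun z => ‖z‖⁻¹ - 1) z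

theorem integrable_coreKernel : Integrable coreKernel := by
  refine IntegrableOn.integrable_indicator ?_ Metric.isClosed_closedBall.measurableSet
  have hK : IsCompact (Metric.closedBall (0 : E3) 1) := isCompact_closedBall _ _
  exact (locallyIntegrable_inv_norm.integrableOn_isCompact hK).sub
    (continuousOn_const.integrableOn_compact hK)

theorem inv_norm_eq (z : E3) : ‖z‖⁻¹ = coreKernel z + (max 1 ‖z‖)⁻¹ := by
  unfold coreKernel
  by_cases h : ‖z‖ ≤ 1
  · rw [Set.indicator_of_mem (by simpa using h), max_eq_left h]; simp
  · rw [Set.indicator_of_notMem (by simpa using h), max_eq_right (le_of_not_ge h)]; simp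

theorem continuous_inv_max_norm : Continuous fun z : E3 => (max 1 ‖z‖)⁻¹ :=
  (continuous_const.max continuous_norm).inv₀ fun _ =>
    (lt_of_lt_of_le one_pos (le_max_left _ _)).ne'

theorem abs_inv_max_norm_le (z : E3) : |(max 1 ‖z‖)⁻¹| ≤ 1 := by
  rw [abs_of_nonneg (by positivity)]
  exact inv_le_one_of_one_le₀ (le_max_left _ _)

namespace IsDensity

variable {u v : E3 → ℝ}

theorem integrable_mul_coreKernel (hu : IsDensity u) (x : E3) :
    Integrable fun y => u y * coreKernel (x - y) := by
  obtain ⟨M, hM⟩ := hu.bounded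
  exact (integrable_coreKernel.comp_sub_left x).bdd_mul hu.continuous.aestronglyMeasurable
    (.of_forall hM)

theorem integrable_mul_inv_max_norm (hu : IsDensity u) (x : E3) :
    Integrable fun y => u y * (max 1 ‖x - y‖)⁻¹ :=
  hu.integrable.mul_bdd (continuous_inv_max_norm.comp
    (continuous_const.sub continuous_id)).aestronglyMeasurable
    (.of_forall fun y => abs_inv_max_norm_le (x - y))

theorem integrable_div (hu : IsDensity u) (x : E3) : Integrable fun y => u y / ‖x - y‖ := by
  refine ((hu.integrable_mul_coreKernel x).add (hu.integrable_mul_inv_max_norm x)).congr ?_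
  exact .of_forall fun y => by simp only [Pi.add_apply, div_eq_mul_inv, inv_norm_eq]; ring

theorem potential_eq (hu : IsDensity u) (x : E3) :
    potential u x = (∫ z, u (x - z) * coreKernel z) + ∫ y, u y * (max 1 ‖x - y‖)⁻¹ := by
  have h1 : ∫ z, u (x - z) * coreKernel z = ∫ y, u y * coreKernel (x - y) := by
    rw [← integral_sub_left_eq_self _ volume x]
    simp
  rw [h1, ← integral_add (hu.integrable_mul_coreKernel x) (hu.integrable_mul_inv_max_norm x)]
  refine integral_congr_ae (.of_forall fun y => ?_)
  simp only [div_eq_mul_inv, inv_norm_eq]; ring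

theorem continuous_potential (hu : IsDensity u) : Continuous (potential u) := by
  rw [funext hu.potential_eq]
  obtain ⟨M, hM⟩ := hu.bounded
  have hc := hu.continuous
  refine Continuous.add ?_ ?_
  · refine continuous_of_dominated (bound := fun z => M * |coreKernel z|) (fun x => ?_)
      (fun x => .of_forall fun z => ?_) (integrable_coreKernel.abs.const_mul M)
      (.of_forall fun z => by fun_prop)
    · exact (hc.comp (continuous_const.sub continuous_id)).aestronglyMeasurable.mul
        integrable_coreKernel.aestronglyMeasurable
    · rw [norm_mul]
      exact mul_le_mul_of_nonneg_right (hM _) (norm_nonneg _)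
  · refine continuous_of_dominated (bound := fun y => |u y|) (fun x => ?_)
      (fun x => .of_forall fun y => ?_) hu.integrable.abs
      (.of_forall fun y => continuous_const.mul
        (continuous_inv_max_norm.comp (continuous_id.sub continuous_const)))
    · exact (hu.integrable_mul_inv_max_norm x).aestronglyMeasurable
    · rw [norm_mul]
      exact mul_le_of_le_one_right (norm_nonneg _) (abs_inv_max_norm_le _)

theorem abs (hu : IsDensity u) : IsDensity fun x => |u x| :=
  ⟨hu.continuous.abs, hu.integrable.abs, by simpa using hu.bounded⟩

theorem add (hu : IsDensity u) (hv : IsDensity v) : IsDensity fun x => u x + v x := by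
  obtain ⟨M, hM⟩ := hu.bounded
  obtain ⟨N, hN⟩ := hv.bounded
  exact ⟨hu.continuous.add hv.continuous, hu.integrable.add hv.integrable,
    M + N, fun x => (abs_add_le _ _).trans (add_le_add (hM x) (hN x))⟩

theorem const_mul (hu : IsDensity u) (c : ℝ) : IsDensity fun x => c * u x := by
  obtain ⟨M, hM⟩ := hu.bounded
  exact ⟨continuous_const.mul hu.continuous, hu.integrable.const_mul c,
    |c| * M, fun x => by rw [abs_mul]; exact mul_le_mul_of_nonneg_left (hM x) (abs_nonneg c)⟩

theorem exists_abs_potential_le (hu : IsDensity u) : ∃ C, ∀ x, |potential u x| ≤ C := by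
  obtain ⟨M, hM⟩ := hu.bounded
  refine ⟨(∫ z, M * |coreKernel z|) + ∫ y, |u y|, fun x => ?_⟩
  rw [hu.potential_eq]
  refine (abs_add_le _ _).trans (add_le_add ?_ ?_)
  · rw [← Real.norm_eq_abs]
    refine norm_integral_le_of_norm_le (integrable_coreKernel.abs.const_mul M)
      (.of_forall fun z => ?_)
    rw [norm_mul]
    exact mul_le_mul_of_nonneg_right (hM _) (norm_nonneg _)
  · rw [← Real.norm_eq_abs]
    refine norm_integral_le_of_norm_le hu.integrable.abs (.of_forall fun y => ?_)
    rw [norm_mul]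
    exact mul_le_of_le_one_right (norm_nonneg _) (abs_inv_max_norm_le _)

theorem integrable_mul_potential (hu : IsDensity u) (hv : IsDensity v) :
    Integrable fun x => u x * potential v x := by
  obtain ⟨C, hC⟩ := hv.exists_abs_potential_le
  exact hu.integrable.mul_bdd hv.continuous_potential.aestronglyMeasurable (.of_forall hC)

theorem integrable_coulomb (hu : IsDensity u) (hv : IsDensity v) :
    Integrable fun p : E3 × E3 => u p.1 * v p.2 / ‖p.1 - p.2‖ := by
  have hcu := hu.continuous
  have hcv := hv.continuous
  have hm : Measurable fun p : E3 × E3 => u p.1 * v p.2 / ‖p.1 - p.2‖ :=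
    ((hcu.comp continuous_fst).mul (hcv.comp continuous_snd)).measurable.div
      (continuous_fst.sub continuous_snd).norm.measurable
  refine (integrable_prod_iff hm.aestronglyMeasurable).2 ⟨.of_forall fun x => ?_, ?_⟩
  · simpa only [mul_div_assoc] using (hv.integrable_div x).const_mul (u x)
  · refine (hu.abs.integrable_mul_potential hv.abs).congr (.of_forall fun x => ?_)
    simp only [potential]
    rw [← integral_const_mul]
    refine integral_congr_ae (.of_forall fun y => ?_)
    simp [mul_div_assoc]

theorem coulomb_eq_integral_integral (hu : IsDensity u) (hv : IsDensity v) :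
    coulomb u v = ∫ x, ∫ y, u x * v y / ‖x - y‖ :=
  integral_prod _ (hu.integrable_coulomb hv)

theorem coulomb_eq_integral_mul_potential (hu : IsDensity u) (hv : IsDensity v) :
    coulomb u v = ∫ x, u x * potential v x := by
  rw [hu.coulomb_eq_integral_integral hv]
  simp only [mul_div_assoc, integral_const_mul, potential]

theorem coulomb_add_left {w : E3 → ℝ} (hu : IsDensity u) (hv : IsDensity v) (hw : IsDensity w) :
    coulomb (fun x => u x + v x) w = coulomb u w + coulomb v w := by
  rw [coulomb, coulomb, coulomb, ← integral_add (hu.integrable_coulomb hw)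
    (hv.integrable_coulomb hw)]
  exact integral_congr_ae (.of_forall fun p => by ring)

end IsDensity

theorem coulomb_comm (u v : E3 → ℝ) : coulomb u v = coulomb v u := by
  rw [coulomb, coulomb, Measure.volume_eq_prod, ← integral_prod_swap]
  refine integral_congr_ae (.of_forall fun p => ?_)
  simp only [Prod.fst_swap, Prod.snd_swap, norm_sub_rev p.2 p.1, mul_comm (u p.2)]

theorem coulomb_const_mul_left (c : ℝ) (u v : E3 → ℝ) :
    coulomb (fun x => c * u x) v = c * coulomb u v := by
  rw [coulomb, coulomb, ← integral_const_mul]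
  exact integral_congr_ae (.of_forall fun p => by ring)

theorem coulomb_const_mul_right (c : ℝ) (u v : E3 → ℝ) :
    coulomb u (fun x => c * v x) = c * coulomb u v := by
  rw [coulomb_comm, coulomb_const_mul_left, coulomb_comm]

theorem IsDensity.coulomb_add_right {u v w : E3 → ℝ} (hu : IsDensity u) (hv : IsDensity v)
    (hw : IsDensity w) : coulomb u (fun x => v x + w x) = coulomb u v + coulomb u w := by
  rw [coulomb_comm, hv.coulomb_add_left hw hu, coulomb_comm v, coulomb_comm w]

theorem SchwartzMap.integrable_norm_sq {F : Type*} [NormedAddCommGroup F] [NormedSpace ℝ F]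
    (f : SchwartzMap E3 F) : Integrable fun x => ‖f x‖ ^ 2 :=
  (memLp_two_iff_integrable_sq_norm f.continuous.aestronglyMeasurable).1 (f.memLp 2)

theorem integrable_norm_fderiv_sq (f : SchwartzMap E3 ℂ) :
    Integrable fun x => ‖fderiv ℝ f x‖ ^ 2 :=
  (SchwartzMap.fderivCLM ℝ E3 ℂ f).integrable_norm_sq

theorem isDensity_norm_sq (f : SchwartzMap E3 ℂ) : IsDensity fun x => ‖f x‖ ^ 2 := by
  refine ⟨f.continuous.norm.pow 2, f.integrable_norm_sq, (SchwartzMap.seminorm ℝ 0 0 f) ^ 2,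
    fun x => ?_⟩
  rw [abs_of_nonneg (by positivity)]
  gcongr
  exact f.norm_le_seminorm ℝ x

theorem DCoul_eq_coulomb (f : SchwartzMap E3 ℂ) :
    DCoul f = coulomb (fun x => ‖f x‖ ^ 2) (fun x => ‖f x‖ ^ 2) :=
  ((isDensity_norm_sq f).coulomb_eq_integral_integral (isDensity_norm_sq f)).symm

theorem pekarF_eq (f : SchwartzMap E3 ℂ) :
    pekarF f = (∫ x : E3, ‖fderiv ℝ f x‖ ^ 2) - DCoul f := rfl

theorem DCoul_smul (c : ℝ) (f : SchwartzMap E3 ℂ) : DCoul (c • f) = c ^ 4 * DCoul f := by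
  simp only [DCoul_eq_coulomb, smul_apply, norm_smul, mul_pow]
  rw [coulomb_const_mul_left, coulomb_const_mul_right, ← mul_assoc]
  congr 1
  rw [norm_eq_abs, sq_abs]; ring

theorem pekarF_smul (c : ℝ) (f : SchwartzMap E3 ℂ) :
    pekarF (c • f) = c ^ 2 * (∫ x : E3, ‖fderiv ℝ f x‖ ^ 2) - c ^ 4 * DCoul f := by
  rw [pekarF_eq, DCoul_smul, ← integral_const_mul]
  congr 2
  funext x
  rw [FunLike.coe_smul, fderiv_const_smul_field, Pi.smul_apply, norm_smul, mul_pow,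
    norm_eq_abs, sq_abs]

theorem scaling_inequality {e : ℝ}
    (he : ∀ η : SchwartzMap E3 ℂ, (∫ x : E3, ‖η x‖ ^ 2) = 1 → e ≤ pekarF η)
    (f : SchwartzMap E3 ℂ) :
    e * (∫ x : E3, ‖f x‖ ^ 2) ^ 2 + DCoul f ≤
      (∫ x : E3, ‖fderiv ℝ f x‖ ^ 2) * ∫ x : E3, ‖f x‖ ^ 2 := by
  set N := ∫ x : E3, ‖f x‖ ^ 2 with hN
  have hN0 : 0 ≤ N := integral_nonneg fun x => by positivity
  rcases hN0.eq_or_lt with h | h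
  · have hf : (fun x => ‖f x‖ ^ 2) = 0 :=
      ((f.continuous.norm.pow 2).ae_eq_iff_eq volume continuous_const).1
        ((integral_eq_zero_iff_of_nonneg (fun x => by positivity) f.integrable_norm_sq).1 h.symm)
    have hD : DCoul f = 0 := by
      rw [DCoul_eq_coulomb, hf]; simp [coulomb]
    simp [hD, ← h]
  · have hs : (√N)⁻¹ ^ 2 = N⁻¹ := by rw [inv_pow, sq_sqrt hN0]
    have h1 := he ((√N)⁻¹ • f) (by
      simp only [smul_apply, norm_smul, mul_pow, norm_eq_abs, sq_abs, hs]
      rw [integral_const_mul, ← hN, inv_mul_cancel₀ h.ne'])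
    rw [pekarF_smul, show (√N)⁻¹ ^ 4 = ((√N)⁻¹ ^ 2) ^ 2 by ring, hs] at h1
    have h2 := mul_le_mul_of_nonneg_right h1 (sq_nonneg N)
    field_simp at h2
    linarith

/-- A smooth function of `t ≥ 0` approximating `√t` from below as `c → ∞`. -/
def approxSqrt (c t : ℝ) : ℝ := c * t * (1 + c ^ 2 * t) ^ (-1 / 2 : ℝ)

theorem sq_rpow_neg_half {s : ℝ} (hs : 0 ≤ s) : (s ^ (-1 / 2 : ℝ)) ^ 2 = s⁻¹ := by
  rw [← rpow_natCast, ← rpow_mul hs]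
  norm_num [rpow_neg_one]

theorem approxSqrt_sq (c : ℝ) {t : ℝ} (ht : 0 ≤ t) :
    approxSqrt c t ^ 2 = c ^ 2 * t ^ 2 / (1 + c ^ 2 * t) := by
  rw [approxSqrt, mul_pow, sq_rpow_neg_half (by positivity)]; ring

theorem hasDerivAt_approxSqrt (c : ℝ) {t : ℝ} (ht : 0 ≤ t) :
    HasDerivAt (approxSqrt c) (c * (1 + c ^ 2 * t) ^ (-1 / 2 : ℝ) * (2 + c ^ 2 * t) /
      (2 * (1 + c ^ 2 * t))) t := by
  have hp : 0 < 1 + c ^ 2 * t := by positivity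
  have h1 : HasDerivAt (fun t : ℝ => 1 + c ^ 2 * t) (c ^ 2) t := by
    simpa using ((hasDerivAt_id t).const_mul (c ^ 2)).const_add 1
  have h2 := h1.rpow_const (p := (-1 / 2 : ℝ)) (Or.inl hp.ne')
  have h3 : HasDerivAt (fun t : ℝ => c * t) c t := by
    simpa using (hasDerivAt_id t).const_mul c
  refine (h3.mul h2).congr_deriv ?_
  rw [rpow_sub_one hp.ne']
  field_simp
  ring

theorem exists_schwartz_approx_modulus (c : ℝ) (f : SchwartzMap E3 ℂ) :
    ∃ g : SchwartzMap E3 ℂ, ∀ x, g x = (approxSqrt c (‖f x‖ ^ 2) : ℂ) := by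
  have h1 : Function.HasTemperateGrowth fun x => (1 + ‖(c • f) x‖ ^ 2) ^ (-1 / 2 : ℝ) :=
    (Function.hasTemperateGrowth_one_add_norm_sq_rpow ℂ (-1 / 2)).comp (c • f).hasTemperateGrowth
  have h2 := Complex.ofRealCLM.hasTemperateGrowth.comp h1
  have h3 := (Complex.conjCLE : ℂ →L[ℝ] ℂ).hasTemperateGrowth.comp (c • f).hasTemperateGrowth
  refine ⟨SchwartzMap.smulLeftCLM ℂ _ f, fun x =>
    (SchwartzMap.smulLeftCLM_apply_apply (h3.mul h2) f x).trans ?_⟩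
  simp only [approxSqrt, Pi.mul_apply, Function.comp_apply, smul_eq_mul, smul_apply,
    norm_smul, mul_pow, norm_eq_abs, sq_abs, Complex.ofRealCLM_apply, Complex.ofReal_mul]
  have : ((‖f x‖ ^ 2 : ℝ) : ℂ) = (starRingEnd ℂ) (f x) * f x := by
    rw [← Complex.normSq_eq_norm_sq, Complex.normSq_eq_conj_mul_self]
  rw [this]
  simp
  ring

theorem hasFDerivAt_norm_sq_comp {f : E3 → ℂ} {x : E3} (hf : DifferentiableAt ℝ f x) :
    HasFDerivAt (fun y => ‖f y‖ ^ 2) (2 • (innerSL ℝ (f x)).comp (fderiv ℝ f x)) x :=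
  hf.hasFDerivAt.norm_sq

theorem norm_fderiv_norm_sq_le (f : SchwartzMap E3 ℂ) (x : E3) :
    ‖fderiv ℝ (fun y => ‖f y‖ ^ 2) x‖ ≤ 2 * ‖f x‖ * ‖fderiv ℝ f x‖ := by
  rw [(hasFDerivAt_norm_sq_comp f.differentiableAt).fderiv, ← Nat.cast_smul_eq_nsmul ℝ, norm_smul]
  have := (innerSL ℝ (f x)).opNorm_comp_le (fderiv ℝ f x)
  rw [innerSL_apply_norm] at this
  simp only [Nat.cast_ofNat, norm_ofNat, mul_assoc]
  linarith

theorem norm_fderiv_approx_modulus {c : ℝ} {f g : SchwartzMap E3 ℂ}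
    (hg : ∀ x, g x = (approxSqrt c (‖f x‖ ^ 2) : ℂ)) (x : E3) :
    ‖fderiv ℝ g x‖ ^ 2 = c ^ 2 * (2 + c ^ 2 * ‖f x‖ ^ 2) ^ 2 / (4 * (1 + c ^ 2 * ‖f x‖ ^ 2) ^ 3) *
      ‖fderiv ℝ (fun y => ‖f y‖ ^ 2) x‖ ^ 2 := by
  have h0 := (hasFDerivAt_norm_sq_comp (f := f) (x := x) f.differentiableAt)
  have h1 := (hasDerivAt_approxSqrt c (t := ‖f x‖ ^ 2) (by positivity)).comp_hasFDerivAt x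
    h0.differentiableAt.hasFDerivAt
  have h2 := Complex.ofRealCLM.hasFDerivAt.comp x h1
  have h3 : (⇑g : E3 → ℂ) = Complex.ofRealCLM ∘ approxSqrt c ∘ fun y => ‖f y‖ ^ 2 :=
    funext hg
  have h4 (L : E3 →L[ℝ] ℝ) : ‖Complex.ofRealCLM ∘SL L‖ = ‖L‖ :=
    Complex.ofRealLI.norm_toContinuousLinearMap_comp
  rw [h3, h2.fderiv, h4, norm_smul, mul_pow, norm_eq_abs, sq_abs,
    div_pow, mul_pow, mul_pow, sq_rpow_neg_half (by positivity)]
  field_simp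
  ring

open Filter Topology in
theorem pekar_le_integral_norm_fderiv_norm {e : ℝ}
    (he : ∀ η : SchwartzMap E3 ℂ, (∫ x : E3, ‖η x‖ ^ 2) = 1 → e ≤ pekarF η)
    (f : SchwartzMap E3 ℂ) :
    e * (∫ x : E3, ‖f x‖ ^ 2) ^ 2 + DCoul f ≤
      (∫ x : E3, ‖fderiv ℝ (fun y => ‖f y‖ ^ 2) x‖ ^ 2 / (4 * ‖f x‖ ^ 2)) *
        ∫ x : E3, ‖f x‖ ^ 2 := by
  choose g hg using fun c => exists_schwartz_approx_modulus c f
  have hgn : ∀ c x, ‖g c x‖ ^ 2 = c ^ 2 * (‖f x‖ ^ 2) ^ 2 / (1 + c ^ 2 * ‖f x‖ ^ 2) := by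
    intro c x
    rw [hg, Complex.norm_real, norm_eq_abs, sq_abs, approxSqrt_sq _ (by positivity)]
  have hle : ∀ c x, ‖g c x‖ ^ 2 ≤ ‖f x‖ ^ 2 := by
    intro c x
    rw [hgn, div_le_iff₀ (by positivity)]
    nlinarith [sq_nonneg ‖f x‖]
  have hlim : Tendsto (fun c : ℝ => (c ^ 2)⁻¹) atTop (𝓝 0) :=
    (tendsto_pow_atTop two_ne_zero).inv_tendsto_atTop
  have hpt : ∀ x, Tendsto (fun c => ‖g c x‖ ^ 2) atTop (𝓝 (‖f x‖ ^ 2)) := by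
    intro x
    simp only [hgn]
    generalize hρ : ‖f x‖ ^ 2 = ρ
    have hρ0 : 0 ≤ ρ := hρ ▸ sq_nonneg _
    rcases hρ0.eq_or_lt with h | h
    · simp [← h]
    have h1 : Tendsto (fun u : ℝ => ρ ^ 2 / (u + ρ)) (𝓝 0) (𝓝 (ρ ^ 2 / (0 + ρ))) :=
      tendsto_const_nhds.div (tendsto_id.add_const ρ) (by positivity)
    have h2 := h1.comp hlim
    rw [show ρ ^ 2 / (0 + ρ) = ρ by field_simp; simp] at h2
    refine h2.congr' ?_
    filter_upwards [eventually_gt_atTop 0] with c hc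
    simp only [Function.comp_apply]
    field_simp
  have hN : Tendsto (fun c => ∫ x, ‖g c x‖ ^ 2) atTop (𝓝 (∫ x, ‖f x‖ ^ 2)) :=
    tendsto_integral_filter_of_dominated_convergence (fun x => ‖f x‖ ^ 2)
      (.of_forall fun c => (g c).integrable_norm_sq.aestronglyMeasurable)
      (.of_forall fun c => .of_forall fun x => by
        rw [norm_of_nonneg (by positivity)]; exact hle c x)
      f.integrable_norm_sq (.of_forall hpt)
  have hD : Tendsto (fun c => DCoul (g c)) atTop (𝓝 (DCoul f)) := by
    simp only [DCoul_eq_coulomb]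
    refine tendsto_integral_filter_of_dominated_convergence
      (fun p : E3 × E3 => ‖f p.1‖ ^ 2 * ‖f p.2‖ ^ 2 / ‖p.1 - p.2‖)
      (.of_forall fun c => ((isDensity_norm_sq (g c)).integrable_coulomb
        (isDensity_norm_sq (g c))).aestronglyMeasurable)
      (.of_forall fun c => .of_forall fun p => ?_)
      ((isDensity_norm_sq f).integrable_coulomb (isDensity_norm_sq f))
      (.of_forall fun p => ((hpt _).mul (hpt _)).div_const _)
    rw [norm_of_nonneg (by positivity)]
    gcongr ?_ * ?_ / _
    · exact hle c _
    · exact hle c _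
  have hT : Tendsto (fun c => ∫ x, ‖fderiv ℝ (g c) x‖ ^ 2) atTop
      (𝓝 (∫ x : E3, ‖fderiv ℝ (fun y => ‖f y‖ ^ 2) x‖ ^ 2 / (4 * ‖f x‖ ^ 2))) := by
    refine tendsto_integral_filter_of_dominated_convergence (fun x => 4 * ‖fderiv ℝ f x‖ ^ 2)
      (.of_forall fun c => (integrable_norm_fderiv_sq (g c)).aestronglyMeasurable)
      (.of_forall fun c => .of_forall fun x => ?_)
      ((integrable_norm_fderiv_sq f).const_mul 4) (.of_forall fun x => ?_)
    · rw [norm_of_nonneg (by positivity), norm_fderiv_approx_modulus (hg c)]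
      have h1 := pow_le_pow_left₀ (norm_nonneg _) (norm_fderiv_norm_sq_le f x) 2
      refine (mul_le_mul_of_nonneg_left h1 (by positivity)).trans ?_
      rw [mul_pow, mul_pow, ← mul_assoc]
      refine mul_le_mul_of_nonneg_right ?_ (by positivity)
      have hs : 0 ≤ c ^ 2 * ‖f x‖ ^ 2 := by positivity
      rw [div_mul_eq_mul_div, div_le_iff₀ (by positivity)]
      generalize ‖f x‖ ^ 2 = ρ at *
      generalize hsd : c ^ 2 * ρ = s at *
      have : c ^ 2 * (2 + s) ^ 2 * (2 ^ 2 * ρ) = 4 * s * (2 + s) ^ 2 := by rw [← hsd]; ring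
      rw [this]
      nlinarith [pow_nonneg hs 2, pow_nonneg hs 3]
    · simp only [norm_fderiv_approx_modulus (hg _)]
      have h1 := norm_fderiv_norm_sq_le f x
      rcases eq_or_ne (f x) 0 with h | h
      · have : ‖fderiv ℝ (fun y => ‖f y‖ ^ 2) x‖ = 0 :=
          le_antisymm (by simpa [h] using h1) (norm_nonneg _)
        simp [this]
      have hρ : 0 < ‖f x‖ ^ 2 := by positivity
      generalize ‖f x‖ ^ 2 = ρ at *
      have h1 : Tendsto (fun u : ℝ => (2 * u + ρ) ^ 2 / (4 * (u + ρ) ^ 3)) (𝓝 0)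
          (𝓝 ((2 * 0 + ρ) ^ 2 / (4 * (0 + ρ) ^ 3))) :=
        (ContinuousAt.div (by fun_prop) (by fun_prop) (by positivity)).tendsto
      have h2 := (h1.comp hlim).mul_const (‖fderiv ℝ (fun y => ‖f y‖ ^ 2) x‖ ^ 2)
      refine (h2.congr' ?_).trans_eq ?_
      · filter_upwards [eventually_gt_atTop 0] with c hc
        simp only [Function.comp_apply]
        field_simp
      · congr 1
        rw [mul_zero, zero_add]
        field_simp
  exact le_of_tendsto_of_tendsto' (((hN.pow 2).const_mul e).add hD) (hT.mul hN)
    fun c => scaling_inequality he (g c)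

theorem fderiv_norm_sq_comp_apply (f : SchwartzMap E3 ℂ) (x v : E3) :
    fderiv ℝ (fun y => ‖f y‖ ^ 2) x v = 2 * (starRingEnd ℂ (f x) * fderiv ℝ f x v).re := by
  rw [(hasFDerivAt_norm_sq_comp f.differentiableAt).fderiv]
  simp [Complex.inner, two_mul]
  ring

theorem im_conj_mul_fderiv_eq_zero_of_dependent {f : SchwartzMap E3 ℂ} {x : E3}
    (hf : 2 * ‖f x‖ * ‖fderiv ℝ f x‖ = ‖fderiv ℝ (fun y => ‖f y‖ ^ 2) x‖) {α β : ℝ}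
    (hαβ : (α, β) ≠ 0)
    (h : ∀ v, α * (starRingEnd ℂ (f x) * fderiv ℝ f x v).im +
      β * fderiv ℝ (fun y => ‖f y‖ ^ 2) x v = 0) (v : E3) :
    (starRingEnd ℂ (f x) * fderiv ℝ f x v).im = 0 := by
  set G := fderiv ℝ (fun y => ‖f y‖ ^ 2) x with hG
  set w := (InnerProductSpace.toDual ℝ E3).symm G with hw
  have hwG : ‖w‖ = ‖G‖ := LinearIsometryEquiv.norm_map _ _
  have hGw : G w = ‖w‖ ^ 2 := by
    rw [← real_inner_self_eq_norm_sq, hw, InnerProductSpace.toDual_symm_apply]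
  have h1 : (starRingEnd ℂ (f x) * fderiv ℝ f x w).im = 0 := by
    have h2 := Complex.sq_norm (starRingEnd ℂ (f x) * fderiv ℝ f x w)
    rw [Complex.normSq_apply, norm_mul, RCLike.norm_conj] at h2
    have h3 : (starRingEnd ℂ (f x) * fderiv ℝ f x w).re = ‖w‖ ^ 2 / 2 := by
      rw [← hGw, hG, fderiv_norm_sq_comp_apply]; ring
    rw [h3] at h2
    have h4 : ‖f x‖ * ‖fderiv ℝ f x w‖ ≤ ‖w‖ ^ 2 / 2 := by
      have := mul_le_mul_of_nonneg_left ((fderiv ℝ f x).le_opNorm w) (norm_nonneg (f x))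
      rw [← hwG] at hf
      calc _ ≤ ‖f x‖ * (‖fderiv ℝ f x‖ * ‖w‖) := this
        _ = 2 * ‖f x‖ * ‖fderiv ℝ f x‖ * ‖w‖ / 2 := by ring
        _ = ‖w‖ ^ 2 / 2 := by rw [hf, sq]
    have h5 := pow_le_pow_left₀ (by positivity) h4 2
    rw [h2] at h5
    nlinarith
  have h2 := h w
  rw [h1, hGw, mul_zero, zero_add] at h2
  rcases mul_eq_zero.1 h2 with h3 | h3
  · have hα : α ≠ 0 := fun hα => hαβ (by rw [hα, h3]; rfl)
    simpa [h3, hα] using h v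
  · have h4 : 2 * ‖f x‖ * ‖fderiv ℝ f x‖ = 0 := by rw [hf, ← hwG]; simpa using h3
    have h5 : f x = 0 ∨ fderiv ℝ f x = 0 := by simpa using h4
    rcases h5 with h5 | h5 <;> simp [h5]

theorem fderiv_im_div_re {f : SchwartzMap E3 ℂ} {x : E3} (hx : (f x).re ≠ 0) (v : E3) :
    fderiv ℝ (fun y => (f y).im / (f y).re) x v =
      (starRingEnd ℂ (f x) * fderiv ℝ f x v).im / (f x).re ^ 2 := by
  have hr := Complex.reCLM.hasFDerivAt.comp x (f.differentiableAt (x := x)).hasFDerivAt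
  have hi := Complex.imCLM.hasFDerivAt.comp x (f.differentiableAt (x := x)).hasFDerivAt
  have h := (hi.mul ((hasDerivAt_inv hx).comp_hasFDerivAt x hr)).fderiv
  have h1 : (fun y => (f y).im / (f y).re) = (Complex.imCLM ∘ f) * (Inv.inv ∘ Complex.reCLM ∘ f) :=
    funext fun y => div_eq_mul_inv _ _
  rw [h1, h]
  simp
  field_simp
  ring

open scoped ContDiff in
theorem contDiffAt_im_div_re {f : SchwartzMap E3 ℂ} {x : E3} (hx : (f x).re ≠ 0) :
    ContDiffAt ℝ ∞ (fun y => (f y).im / (f y).re) x :=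
  (Complex.imCLM.contDiff.comp (f.smooth ⊤)).contDiffAt.div
    (Complex.reCLM.contDiff.comp (f.smooth ⊤)).contDiffAt hx

theorem exists_critical_point_of_phase {f : SchwartzMap E3 ℂ}
    (hf : ∀ x, 2 * ‖f x‖ * ‖fderiv ℝ f x‖ = ‖fderiv ℝ (fun y => ‖f y‖ ^ 2) x‖)
    {x₁ : E3} (hx₁ : 0 < (f x₁).re) :
    ∃ x, 0 < (f x).re ∧ (f x).im / (f x).re = (f x₁).im / (f x₁).re ∧
      ∀ v, (starRingEnd ℂ (f x) * fderiv ℝ f x v).im = 0 := by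
  set τ := (f x₁).im / (f x₁).re with hτ
  have hc := f.continuous
  have hf₁ : 0 < ‖f x₁‖ := hx₁.trans_le (Complex.re_le_norm _)
  set K : Set E3 := {x | ‖f x₁‖ ≤ ‖f x‖ ∧ (f x).im = τ * (f x).re ∧ 0 ≤ (f x).re} with hK
  have hKc : IsCompact K := by
    have h1 : {x | ‖f x₁‖ ≤ ‖f x‖}ᶜ ∈ Filter.cocompact E3 := by
      filter_upwards [(zero_at_infty f).norm.eventually_lt_const (by rwa [norm_zero])] with x hx
      simpa using hx
    obtain ⟨K', hK', hsub⟩ := Filter.mem_cocompact'.1 h1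
    refine hK'.of_isClosed_subset ?_ fun x hx => hsub (by simpa using hx.1)
    have e1 : IsClosed {x | ‖f x₁‖ ≤ ‖f x‖} := isClosed_le continuous_const hc.norm
    have e2 : IsClosed {x | (f x).im = τ * (f x).re} :=
      isClosed_eq (Complex.continuous_im.comp hc)
        (continuous_const.mul (Complex.continuous_re.comp hc))
    have e3 : IsClosed {x | 0 ≤ (f x).re} :=
      isClosed_le continuous_const (Complex.continuous_re.comp hc)
    exact e1.inter (e2.inter e3)
  have hK₁ : x₁ ∈ K := ⟨le_rfl, by rw [hτ]; field_simp, hx₁.le⟩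
  obtain ⟨x, hxK, hmax⟩ := hKc.exists_isMaxOn ⟨x₁, hK₁⟩ (hc.norm.pow 2).continuousOn
  have hre : 0 < (f x).re := by
    refine hxK.2.2.lt_of_ne fun h => ?_
    have h0 : f x = 0 := Complex.ext h.symm (by rw [hxK.2.1, ← h]; simp)
    have := hxK.1
    rw [h0, norm_zero] at this
    exact absurd this (not_le.2 hf₁)
  have htx : (f x).im / (f x).re = τ := by rw [hxK.2.1]; field_simp
  refine ⟨x, hre, htx, ?_⟩
  have hext : IsLocalExtrOn (fun y => ‖f y‖ ^ 2)
      {y | (f y).im / (f y).re = (f x).im / (f x).re} x := by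
    refine Or.inr (Filter.mem_of_superset (inter_mem_nhdsWithin _
      (((Complex.continuous_re.comp hc).tendsto x).eventually_const_lt hre)) ?_)
    rintro y ⟨hy1, hy2⟩
    have hy2' : 0 < (f y).re := hy2
    have hy1' : (f y).im / (f y).re = τ := Eq.trans hy1 htx
    rcases le_or_gt ‖f x₁‖ ‖f y‖ with h | h
    · exact hmax ⟨h, by rw [← hy1']; field_simp, hy2'.le⟩
    · exact pow_le_pow_left₀ (norm_nonneg _) (h.le.trans hxK.1) 2
  obtain ⟨α, β, hαβ, h⟩ := hext.exists_multipliers_of_hasStrictFDerivAt_1d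
    ((contDiffAt_im_div_re hre.ne').hasStrictFDerivAt (by simp))
    (((f.smooth 1).norm_sq ℝ).contDiffAt.hasStrictFDerivAt (by simp))
  refine im_conj_mul_fderiv_eq_zero_of_dependent (hf x)
    (α := α / (f x).re ^ 2) (β := β) (fun h0 => hαβ ?_) fun v => ?_
  · have h1 := congrArg Prod.fst h0
    have h2 := congrArg Prod.snd h0
    have h3 : α = 0 := by simpa [hre.ne'] using h1
    exact Prod.ext h3 h2
  · have h1 := DFunLike.congr_fun h v
    simp only [add_apply, smul_apply, smul_eq_mul,
      fderiv_im_div_re hre.ne'] at h1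
    refine Eq.trans ?_ (h1.trans (zero_apply v))
    ring

theorem im_conj_mul_fderiv_eq_zero_of_re_pos {f : SchwartzMap E3 ℂ}
    (hf : ∀ x, 2 * ‖f x‖ * ‖fderiv ℝ f x‖ = ‖fderiv ℝ (fun y => ‖f y‖ ^ 2) x‖)
    {x₀ : E3} (hx₀ : 0 < (f x₀).re) (v : E3) :
    (starRingEnd ℂ (f x₀) * fderiv ℝ f x₀ v).im = 0 := by
  by_contra hv
  set t : E3 → ℝ := fun y => (f y).im / (f y).re with ht
  have hcd : ∀ {x : E3}, 0 < (f x).re → ContDiffAt ℝ (⊤ : ℕ∞) t x :=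
    fun hx => contDiffAt_im_div_re hx.ne'
  have hne : fderiv ℝ t x₀ ≠ 0 := fun h => hv <| by
    have := fderiv_im_div_re hx₀.ne' v
    rw [← ht, h] at this
    simpa [hx₀.ne'] using this.symm
  have hsurj : (fderiv ℝ t x₀ : E3 →L[ℝ] ℝ).range = ⊤ :=
    LinearMap.range_eq_top.2 (LinearMap.surjective fun h => hne
      (ContinuousLinearMap.coe_injective h))
  have hmap := ((hcd hx₀).hasStrictFDerivAt (by simp)).map_nhds_eq_of_surj hsurj
  have hU : {x | 0 < (f x).re} ∈ nhds x₀ :=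
    ((Complex.continuous_re.comp f.continuous).tendsto x₀).eventually_const_lt hx₀
  have hS : t '' {x | 0 < (f x).re} ⊆ t '' {x | 0 < (f x).re ∧ fderiv ℝ t x = 0} := by
    rintro _ ⟨x₁, hx₁, rfl⟩
    obtain ⟨x, hx, htx, h⟩ := exists_critical_point_of_phase hf hx₁
    refine ⟨x, ⟨hx, ContinuousLinearMap.ext fun w => ?_⟩, htx⟩
    rw [fderiv_im_div_re hx.ne', h w]; simp
  have h0 := volume_image_critical_eq_zero
    (S := {x | 0 < (f x).re ∧ fderiv ℝ t x = 0}) (fun x hx => hcd hx.1) (fun x hx => hx.2)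
  have h1 : t '' {x | 0 < (f x).re} ∈ nhds (t x₀) := hmap ▸ Filter.image_mem_map hU
  exact (Measure.measure_pos_of_mem_nhds volume (Filter.mem_of_superset h1 hS)).ne' h0

theorem im_conj_mul_fderiv_eq_zero {f : SchwartzMap E3 ℂ}
    (hf : ∀ x, 2 * ‖f x‖ * ‖fderiv ℝ f x‖ = ‖fderiv ℝ (fun y => ‖f y‖ ^ 2) x‖)
    (x v : E3) : (starRingEnd ℂ (f x) * fderiv ℝ f x v).im = 0 := by
  by_cases hx : f x = 0
  · simp [hx]
  set c := starRingEnd ℂ (f x) with hc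
  have hD : ∀ y, fderiv ℝ (c • f) y = c • fderiv ℝ f y := fun y => by
    rw [FunLike.coe_smul, fderiv_const_smul f.differentiableAt]
  have h1 : ∀ y, 2 * ‖(c • f) y‖ * ‖fderiv ℝ (c • f) y‖ =
      ‖fderiv ℝ (fun y => ‖(c • f) y‖ ^ 2) y‖ := fun y => by
    have : (fun y => ‖(c • f) y‖ ^ 2) = fun y => ‖c‖ ^ 2 • ‖f y‖ ^ 2 := by
      ext y; rw [smul_apply, norm_smul, mul_pow, smul_eq_mul]
    rw [this, fderiv_fun_const_smul
      (hasFDerivAt_norm_sq_comp f.differentiableAt).differentiableAt, norm_smul, ← hf, hD,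
      smul_apply, norm_smul, norm_smul, norm_pow, norm_norm]
    ring
  have h2 : (c • f) x = (‖f x‖ ^ 2 : ℝ) := by
    rw [smul_apply, smul_eq_mul, hc, ← Complex.normSq_eq_conj_mul_self, Complex.normSq_eq_norm_sq]
  have h3 := im_conj_mul_fderiv_eq_zero_of_re_pos h1 (x₀ := x)
    (by rw [h2, Complex.ofReal_re]; positivity) v
  rw [h2, hD, smul_apply, smul_eq_mul, Complex.conj_ofReal,
    Complex.im_ofReal_mul] at h3
  simpa [hx] using h3

theorem sum_norm_fderiv_sq {f : SchwartzMap E3 ℂ}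
    (hf : ∀ x, 2 * ‖f x‖ * ‖fderiv ℝ f x‖ = ‖fderiv ℝ (fun y => ‖f y‖ ^ 2) x‖)
    {x : E3} (hx : f x ≠ 0) :
    ∑ i : Fin 3, ‖fderiv ℝ f x (EuclideanSpace.single i 1)‖ ^ 2 = ‖fderiv ℝ f x‖ ^ 2 := by
  set G := fderiv ℝ (fun y => ‖f y‖ ^ 2) x with hG
  set w := (InnerProductSpace.toDual ℝ E3).symm G with hw
  have hwG : ‖w‖ = ‖G‖ := LinearIsometryEquiv.norm_map _ _
  have hwi : ∀ i, w i = G (EuclideanSpace.single i 1) := fun i => by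
    rw [← InnerProductSpace.toDual_symm_apply, EuclideanSpace.inner_single_right]; simp [hw]
  have h1 : ∀ i : Fin 3, (2 * ‖f x‖) ^ 2 * ‖fderiv ℝ f x (EuclideanSpace.single i 1)‖ ^ 2 =
      ‖w i‖ ^ 2 := fun i => by
    rw [hwi, hG, fderiv_norm_sq_comp_apply, norm_eq_abs, sq_abs, mul_pow, mul_pow, mul_assoc,
      ← mul_pow, ← RCLike.norm_conj (f x), ← norm_mul, Complex.sq_norm, Complex.normSq_apply,
      im_conj_mul_fderiv_eq_zero hf]
    ring
  have h2 := EuclideanSpace.norm_sq_eq w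
  rw [hwG, ← hf x, mul_pow, ← Finset.sum_congr rfl fun i _ => h1 i, ← Finset.mul_sum] at h2
  exact (mul_left_cancel₀ (by positivity) h2).symm

theorem integral_norm_fderiv_sq_of_minimizer {ψ : SchwartzMap E3 ℂ}
    (hψ : (∫ x : E3, ‖ψ x‖ ^ 2) = 1)
    (hmin : ∀ η : SchwartzMap E3 ℂ, (∫ x : E3, ‖η x‖ ^ 2) = 1 → pekarF ψ ≤ pekarF η) :
    (∫ x : E3, ‖fderiv ℝ ψ x‖ ^ 2) =
      ∫ x : E3, ∑ i : Fin 3, ‖fderiv ℝ ψ x (EuclideanSpace.single i 1)‖ ^ 2 := by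
  set A : E3 → ℝ := fun x => ‖fderiv ℝ (fun y => ‖ψ y‖ ^ 2) x‖ ^ 2 / (4 * ‖ψ x‖ ^ 2) with hA
  have hcρ : Continuous fun x => fderiv ℝ (fun y => ‖ψ y‖ ^ 2) x :=
    ((ψ.smooth 1).norm_sq ℝ).continuous_fderiv one_ne_zero
  have hcψ : Continuous fun x => fderiv ℝ ψ x := (ψ.smooth 1).continuous_fderiv one_ne_zero
  have hle : ∀ x, A x ≤ ‖fderiv ℝ ψ x‖ ^ 2 := fun x => by
    refine div_le_of_le_mul₀ (by positivity) (by positivity) ?_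
    have h1 := pow_le_pow_left₀ (norm_nonneg _) (norm_fderiv_norm_sq_le ψ x) 2
    linarith
  have hAi : Integrable A := (integrable_norm_fderiv_sq ψ).mono'
    (hcρ.norm.pow 2 |>.measurable.div
      (continuous_const.mul (ψ.continuous.norm.pow 2)).measurable).aestronglyMeasurable
    (.of_forall fun x => by rw [norm_of_nonneg (by positivity)]; exact hle x)
  have h1 := pekar_le_integral_norm_fderiv_norm hmin ψ
  rw [hψ, pekarF_eq, one_pow, mul_one, mul_one, sub_add_cancel] at h1
  have hae : (fun x => ‖fderiv ℝ ψ x‖ ^ 2 - A x) =ᵐ[volume] 0 := by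
    refine (integral_eq_zero_iff_of_nonneg (fun x => sub_nonneg.2 (hle x))
      ((integrable_norm_fderiv_sq ψ).sub hAi)).1 (le_antisymm ?_
      (integral_nonneg fun x => sub_nonneg.2 (hle x)))
    rw [integral_sub (integrable_norm_fderiv_sq ψ) hAi]
    linarith
  have heq : (fun x => 2 * ‖ψ x‖ * ‖fderiv ℝ ψ x‖) =
      fun x => ‖fderiv ℝ (fun y => ‖ψ y‖ ^ 2) x‖ := by
    refine (Continuous.ae_eq_iff_eq volume (by fun_prop) hcρ.norm).1 ?_
    filter_upwards [hae] with x hx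
    by_cases h0 : ψ x = 0
    · have := norm_fderiv_norm_sq_le ψ x
      rw [h0, norm_zero, mul_zero, zero_mul] at this
      rw [h0, norm_zero, mul_zero, zero_mul]
      exact (le_antisymm this (norm_nonneg _)).symm
    · have h2 : ‖fderiv ℝ ψ x‖ ^ 2 = A x := sub_eq_zero.1 hx
      rw [hA, eq_div_iff (by positivity)] at h2
      refine (sq_eq_sq₀ (by positivity) (by positivity)).1 ?_
      rw [← h2]; ring
  refine integral_congr_ae ?_
  filter_upwards [hae] with x hx
  by_cases h0 : ψ x = 0
  · have h2 : ‖fderiv ℝ ψ x‖ ^ 2 = 0 := by simpa [hA, h0] using hx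
    have h3 : fderiv ℝ ψ x = 0 := by simpa using h2
    simp [h3]
  · exact (sum_norm_fderiv_sq (congrFun heq) h0).symm

/-- The real `L²` inner product of Schwartz functions. -/
def realInner (f g : SchwartzMap E3 ℂ) : ℝ := ∫ x, inner ℝ (f x) (g x)

theorem inner_eq_norm_sq_add (z w : ℂ) :
    inner ℝ z w = 2⁻¹ * (‖z + w‖ ^ 2 + (-1 * ‖z‖ ^ 2 + -1 * ‖w‖ ^ 2)) := by
  rw [norm_add_sq_real]; ring

theorem isDensity_inner (f g : SchwartzMap E3 ℂ) : IsDensity fun x => inner ℝ (f x) (g x) := by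
  simp only [inner_eq_norm_sq_add]
  exact ((isDensity_norm_sq (f + g)).add
    (((isDensity_norm_sq f).const_mul _).add ((isDensity_norm_sq g).const_mul _))).const_mul _

theorem norm_sq_add_smul (f g : SchwartzMap E3 ℂ) (t : ℝ) (x : E3) :
    ‖(f + t • g) x‖ ^ 2 =
      ‖f x‖ ^ 2 + (t * (2 * inner ℝ (f x) (g x)) + t ^ 2 * ‖g x‖ ^ 2) := by
  rw [add_apply, smul_apply, norm_add_sq_real, norm_smul, inner_smul_right, mul_pow, norm_eq_abs,
    sq_abs]
  ring

theorem integral_norm_sq_add_smul (f g : SchwartzMap E3 ℂ) (t : ℝ) :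
    (∫ x, ‖(f + t • g) x‖ ^ 2) =
      (∫ x, ‖f x‖ ^ 2) + (t * (2 * realInner f g) + t ^ 2 * ∫ x, ‖g x‖ ^ 2) := by
  have h := ((isDensity_inner f g).const_mul 2).integrable
  have h2 : Integrable fun x => t * (2 * inner ℝ (f x) (g x)) + t ^ 2 * ‖g x‖ ^ 2 :=
    (h.const_mul t).add (g.integrable_norm_sq.const_mul _)
  simp only [norm_sq_add_smul, realInner]
  rw [integral_add f.integrable_norm_sq h2,
    integral_add (h.const_mul t) (g.integrable_norm_sq.const_mul _), integral_const_mul,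
    integral_const_mul, integral_const_mul]

theorem IsDensity.coulomb_add_self {u v : E3 → ℝ} (hu : IsDensity u) (hv : IsDensity v) :
    coulomb (fun x => u x + v x) (fun x => u x + v x) =
      coulomb u u + 2 * coulomb u v + coulomb v v := by
  rw [hu.coulomb_add_left hv (hu.add hv), hu.coulomb_add_right hu hv, hv.coulomb_add_right hu hv,
    coulomb_comm v u]
  ring

theorem DCoul_add_smul (f g : SchwartzMap E3 ℂ) : ∃ a₂ a₃ a₄ : ℝ, ∀ t : ℝ,
    DCoul (f + t • g) = DCoul f +
      t * (4 * coulomb (fun x => ‖f x‖ ^ 2) (fun x => inner ℝ (f x) (g x))) +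
        t ^ 2 * a₂ + t ^ 3 * a₃ + t ^ 4 * a₄ := by
  have hu := isDensity_norm_sq f
  have hv := (isDensity_inner f g).const_mul 2
  have hw := isDensity_norm_sq g
  refine ⟨coulomb (fun x => 2 * inner ℝ (f x) (g x)) (fun x => 2 * inner ℝ (f x) (g x)) +
      2 * coulomb (fun x => ‖f x‖ ^ 2) (fun x => ‖g x‖ ^ 2),
    2 * coulomb (fun x => 2 * inner ℝ (f x) (g x)) (fun x => ‖g x‖ ^ 2),
    coulomb (fun x => ‖g x‖ ^ 2) (fun x => ‖g x‖ ^ 2), fun t => ?_⟩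
  simp only [DCoul_eq_coulomb, norm_sq_add_smul]
  rw [hu.coulomb_add_self ((hv.const_mul t).add (hw.const_mul (t ^ 2))),
    (hv.const_mul t).coulomb_add_self (hw.const_mul (t ^ 2)),
    hu.coulomb_add_right (hv.const_mul t) (hw.const_mul (t ^ 2))]
  simp only [coulomb_const_mul_left, coulomb_const_mul_right]
  ring

theorem eq_zero_of_polynomial_nonneg {a₁ a₂ a₃ a₄ : ℝ}
    (h : ∀ t : ℝ, 0 ≤ t * a₁ + t ^ 2 * a₂ + t ^ 3 * a₃ + t ^ 4 * a₄) : a₁ = 0 := by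
  have hd : HasDerivAt (fun t : ℝ => t * a₁ + t ^ 2 * a₂ + t ^ 3 * a₃ + t ^ 4 * a₄) a₁ 0 := by
    refine (((((hasDerivAt_id (0 : ℝ)).mul_const a₁).add
      ((hasDerivAt_pow 2 (0 : ℝ)).mul_const a₂)).add
      ((hasDerivAt_pow 3 (0 : ℝ)).mul_const a₃)).add
      ((hasDerivAt_pow 4 (0 : ℝ)).mul_const a₄)).congr_deriv ?_
    simp
  exact IsLocalMin.hasDerivAt_eq_zero (.of_forall fun t => by simpa using h t) hd

theorem norm_sq_le_sum_norm_apply_single_sq (L : E3 →L[ℝ] ℂ) :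
    ‖L‖ ^ 2 ≤ ∑ i : Fin 3, ‖L (EuclideanSpace.single i 1)‖ ^ 2 := by
  set S := ∑ i : Fin 3, ‖L (EuclideanSpace.single i 1)‖ ^ 2
  have hS : 0 ≤ S := Finset.sum_nonneg fun i _ => by positivity
  refine (le_sqrt (norm_nonneg _) hS).1 (L.opNorm_le_bound (sqrt_nonneg _) fun v => ?_)
  have hv : L v = ∑ i : Fin 3, v i • L (EuclideanSpace.single i 1) := by
    conv_lhs => rw [← (EuclideanSpace.basisFun (Fin 3) ℝ).sum_repr v]
    simp
  refine (sq_le_sq₀ (norm_nonneg _) (by positivity)).1 ?_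
  rw [mul_pow, sq_sqrt hS, EuclideanSpace.norm_sq_eq, mul_comm]
  calc ‖L v‖ ^ 2 ≤ (∑ i : Fin 3, ‖v i‖ * ‖L (EuclideanSpace.single i 1)‖) ^ 2 := by
        rw [hv]
        gcongr
        exact norm_sum_le_of_le _ fun i _ => (norm_smul _ _).le
    _ ≤ _ := Finset.sum_mul_sq_le_sq_mul_sq _ _ _

open scoped LineDeriv in
/-- The partial derivative of a Schwartz function in the `i`-th coordinate direction. -/
def partialDeriv (i : Fin 3) (f : SchwartzMap E3 ℂ) : SchwartzMap E3 ℂ :=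
  ∂_{(EuclideanSpace.single i 1 : E3)} f

theorem partialDeriv_apply (i : Fin 3) (f : SchwartzMap E3 ℂ) (x : E3) :
    partialDeriv i f x = fderiv ℝ f x (EuclideanSpace.single i 1) :=
  SchwartzMap.lineDerivOp_apply_eq_fderiv _ f x

theorem partialDeriv_add_smul (i : Fin 3) (f g : SchwartzMap E3 ℂ) (t : ℝ) :
    partialDeriv i (f + t • g) = partialDeriv i f + t • partialDeriv i g := by
  simp only [partialDeriv, LineDeriv.lineDerivOp_add, LineDeriv.lineDerivOp_smul]

theorem realInner_partialDeriv (i : Fin 3) (f g : SchwartzMap E3 ℂ) :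
    realInner f (partialDeriv i g) = -realInner (partialDeriv i f) g :=
  SchwartzMap.integral_bilinear_lineDerivOp_right_eq_neg_left f g (innerSL ℝ) _

theorem lap_eq_sum (f : SchwartzMap E3 ℂ) (x : E3) :
    lap f x = ∑ i : Fin 3, partialDeriv i (partialDeriv i f) x := by
  simp only [lap, partialDeriv_apply]
  refine Finset.sum_congr rfl fun i _ => ?_
  rw [← funext (partialDeriv_apply i f)]

theorem integral_norm_fderiv_sq_le (f : SchwartzMap E3 ℂ) :
    (∫ x, ‖fderiv ℝ f x‖ ^ 2) ≤ ∑ i : Fin 3, ∫ x, ‖partialDeriv i f x‖ ^ 2 := by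
  rw [← integral_finsetSum _ fun i _ => (partialDeriv i f).integrable_norm_sq]
  refine integral_mono (integrable_norm_fderiv_sq f)
    (integrable_finsetSum _ fun i _ => (partialDeriv i f).integrable_norm_sq) fun x => ?_
  simp only [partialDeriv_apply]
  exact norm_sq_le_sum_norm_apply_single_sq _

theorem weak_choquard {ψ : SchwartzMap E3 ℂ}
    (hψ : (∫ x : E3, ‖ψ x‖ ^ 2) = 1)
    (hmin : ∀ η : SchwartzMap E3 ℂ, (∫ x : E3, ‖η x‖ ^ 2) = 1 → pekarF ψ ≤ pekarF η)
    (η : SchwartzMap E3 ℂ) :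
    (∑ i : Fin 3, realInner (partialDeriv i ψ) (partialDeriv i η)) -
      2 * coulomb (fun x => ‖ψ x‖ ^ 2) (fun x => inner ℝ (ψ x) (η x)) =
        (pekarF ψ - DCoul ψ) * realInner ψ η := by
  set τ := ∑ i : Fin 3, realInner (partialDeriv i ψ) (partialDeriv i η) with hτ
  set c := coulomb (fun x => ‖ψ x‖ ^ 2) (fun x => inner ℝ (ψ x) (η x))
  set n₁ := realInner ψ η
  set n₂ := ∫ x, ‖η x‖ ^ 2
  set k := ∑ i : Fin 3, ∫ x, ‖partialDeriv i η x‖ ^ 2 with hk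
  have hT0 : ∑ i : Fin 3, ∫ x, ‖partialDeriv i ψ x‖ ^ 2 = pekarF ψ + DCoul ψ := by
    rw [pekarF_eq, sub_add_cancel, integral_norm_fderiv_sq_of_minimizer hψ hmin,
      ← integral_finsetSum _ fun i _ => (partialDeriv i ψ).integrable_norm_sq]
    simp only [partialDeriv_apply]
  have hT (t : ℝ) : ∑ i : Fin 3, ∫ x, ‖partialDeriv i (ψ + t • η) x‖ ^ 2 =
      pekarF ψ + DCoul ψ + (t * (2 * τ) + t ^ 2 * k) := by
    simp only [partialDeriv_add_smul, integral_norm_sq_add_smul, Finset.sum_add_distrib, hT0,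
      ← Finset.mul_sum, hτ, hk]
  obtain ⟨a₂, a₃, a₄, hD⟩ := DCoul_add_smul ψ η
  set e := pekarF ψ
  set d := DCoul ψ
  have key (t : ℝ) := (scaling_inequality hmin (ψ + t • η)).trans
    (mul_le_mul_of_nonneg_right (integral_norm_fderiv_sq_le (ψ + t • η))
      (integral_nonneg fun x => sq_nonneg _))
  have h0 := eq_zero_of_polynomial_nonneg
    (a₁ := 2 * (τ - 2 * c - (e - d) * n₁))
    (a₂ := (e + d) * n₂ + 4 * τ * n₁ + k - a₂ - e * (2 * n₂ + 4 * n₁ ^ 2))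
    (a₃ := 2 * τ * n₂ + 2 * k * n₁ - a₃ - 4 * e * n₁ * n₂)
    (a₄ := k * n₂ - a₄ - e * n₂ ^ 2) fun t => by
      have h := key t
      rw [hT, hD, integral_norm_sq_add_smul, hψ] at h
      refine (sub_nonneg.2 h).trans_eq ?_
      ring
  linarith

/-- A normalized minimizer of the Pekar functional satisfies the Choquard
Euler–Lagrange equation. -/
theorem pekar_minimizer_choquard (ψ : SchwartzMap E3 ℂ)
    (hψ : (∫ x : E3, ‖ψ x‖ ^ 2) = 1)
    (hmin : ∀ η : SchwartzMap E3 ℂ, (∫ x : E3, ‖η x‖ ^ 2) = 1 →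
      pekarF ψ ≤ pekarF η) :
    ∀ x : E3,
      -lap ψ x - 2 * ((∫ y : E3, ‖ψ y‖ ^ 2 / ‖x - y‖ : ℝ) : ℂ) * ψ x
        = ((pekarF ψ - DCoul ψ : ℝ) : ℂ) * ψ x := by
  have hρ := isDensity_norm_sq ψ
  set R : E3 → ℂ := fun x => -lap ψ x - 2 * (potential (fun y => ‖ψ y‖ ^ 2) x : ℂ) * ψ x
    - ((pekarF ψ - DCoul ψ : ℝ) : ℂ) * ψ x with hR
  have hRc : Continuous R := by
    have h1 : Continuous fun x => lap ψ x := by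
      simp only [lap_eq_sum]
      exact continuous_finsetSum _ fun i _ => (partialDeriv i (partialDeriv i ψ)).continuous
    have h2 := Complex.continuous_ofReal.comp hρ.continuous_potential
    exact (h1.neg.sub ((continuous_const.mul h2).mul ψ.continuous)).sub
      (continuous_const.mul ψ.continuous)
  have hweak (η : SchwartzMap E3 ℂ) : ∫ x, inner ℝ (R x) (η x) = 0 := by
    have hw := weak_choquard hψ hmin η
    have hi (i : Fin 3) := (isDensity_inner (partialDeriv i (partialDeriv i ψ)) η).integrable
    have hp := (isDensity_inner ψ η).integrable_mul_potential hρ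
    have hpt (x : E3) : inner ℝ (R x) (η x) =
        -(∑ i : Fin 3, inner ℝ (partialDeriv i (partialDeriv i ψ) x) (η x)) -
          2 * (inner ℝ (ψ x) (η x) * potential (fun y => ‖ψ y‖ ^ 2) x) -
            (pekarF ψ - DCoul ψ) * inner ℝ (ψ x) (η x) := by
      have h1 (r : ℝ) (z w : ℂ) : inner ℝ ((r : ℂ) * z) w = r * inner ℝ z w := by
        rw [← Complex.real_smul, real_inner_smul_left]
      have h2 : (2 * (potential (fun y => ‖ψ y‖ ^ 2) x : ℂ)) =
        ((2 * potential (fun y => ‖ψ y‖ ^ 2) x : ℝ) : ℂ) := by push_cast; rfl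
      rw [hR]
      simp only [h2, inner_sub_left, inner_neg_left, h1, lap_eq_sum, sum_inner]
      ring
    have hs := integrable_finsetSum Finset.univ fun i _ => hi i
    have hsn : Integrable fun x =>
        -∑ i : Fin 3, inner ℝ (partialDeriv i (partialDeriv i ψ) x) (η x) := hs.neg
    have hsp : Integrable fun x =>
        -(∑ i : Fin 3, inner ℝ (partialDeriv i (partialDeriv i ψ) x) (η x)) -
          2 * (inner ℝ (ψ x) (η x) * potential (fun y => ‖ψ y‖ ^ 2) x) :=
      hsn.sub (hp.const_mul 2)
    simp only [hpt]
    rw [integral_sub hsp ((isDensity_inner ψ η).integrable.const_mul _),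
      integral_sub hsn (hp.const_mul 2),
      integral_neg, integral_finsetSum _ fun i _ => hi i, integral_const_mul, integral_const_mul,
      ← (isDensity_inner ψ η).coulomb_eq_integral_mul_potential hρ, coulomb_comm]
    simp only [realInner_partialDeriv] at hw
    rw [Finset.sum_neg_distrib] at hw
    simp only [realInner] at hw
    linarith
  have hzero (c : ℂ) (x : E3) : inner ℝ (R x) c = 0 := by
    have hcont : Continuous fun x => inner ℝ (R x) c := hRc.inner continuous_const
    have hae : (fun x => inner ℝ (R x) c) =ᵐ[volume] fun _ => (0 : ℝ) := by
      refine ae_eq_zero_of_integral_contDiff_smul_eq_zero hcont.locallyIntegrable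
        fun g hg hgc => ?_
      have h := hweak ((hgc.smul_right (f' := fun _ => c)).toSchwartzMap
        (hg.smul contDiff_const))
      simpa only [HasCompactSupport.toSchwartzMap_toFun, Pi.smul_apply', inner_smul_right,
        smul_eq_mul] using h
    exact congrFun ((hcont.ae_eq_iff_eq volume continuous_const).1 hae) x
  intro x
  exact sub_eq_zero.1 (inner_self_eq_zero.1 (hzero (R x) x))

end
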